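/- Let M be a countable set and G ≤ Sym(M) a permutation group such that for every a ∈ M, all orbits of the stabilizer G_a on M ∖ {a} are infinite. Let Ω = [0,1]^M carry the product σ-algebra and the shift action, and let μ be a G-invariant Borel probability measure on Ω. For a ∈ M, let F_a be the σ-field of measurable sets s with μ(g·s △ s) = 0 for all g ∈ G_a, and let T be the dynamical tail σ-field. Then, up to μ-null sets, T ∩ (⋁_{a∈M} F_a) coincides with the σ-field generated by ⋃_{a∈M} (T ∩ F_a): every event in the former differs by a μ-null set from an event in the latter, and conversely. -/

import Mathlib

open MeasureTheory ProbabilityTheory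

/-- The shift action of a permutation `g` of `M` on configurations `ω : M → [0,1]`:
`(g · ω)(a) = ω (g⁻¹ a)`. -/
def shiftAct {M : Type*} (g : Equiv.Perm M) (ω : M → unitInterval) : M → unitInterval :=
  fun a => ω (g⁻¹ a)

/-- The σ-field `F_A` of events invariant (mod `μ`-null sets) under the pointwise
stabilizer `G_{(A)}`. -/
def invField {M : Type*} (G : Subgroup (Equiv.Perm M)) (μ : Measure (M → unitInterval))
    (A : Set M) : MeasurableSpace (M → unitInterval) :=
  MeasurableSpace.generateFrom
    {s : Set (M → unitInterval) | MeasurableSet s ∧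
      ∀ g ∈ G, (∀ a ∈ A, g a = a) → μ (symmDiff (shiftAct g ⁻¹' s) s) = 0}

/-- For arbitrary `D ⊆ M`, the σ-field `F_D` generated by the `F_A` for finite `A ⊆ D`. -/
def invFieldOf {M : Type*} (G : Subgroup (Equiv.Perm M)) (μ : Measure (M → unitInterval))
    (D : Set M) : MeasurableSpace (M → unitInterval) :=
  ⨆ (A : Finset M) (_ : (A : Set M) ⊆ D), invField G μ (A : Set M)

/-- The dynamical tail σ-field `T = ⋂ {F_{M ∖ A} : A ⊆ M finite}`. -/
def dynTailField {M : Type*} (G : Subgroup (Equiv.Perm M))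
    (μ : Measure (M → unitInterval)) : MeasurableSpace (M → unitInterval) :=
  ⨅ A : Finset M, invFieldOf G μ ((A : Set M)ᶜ)

theorem exists_forall_isometry_eq_of_isClosed_convex {H ι : Type*} [NormedAddCommGroup H]
    [InnerProductSpace ℝ H] [CompleteSpace H] (U : ι → H →ₗᵢ[ℝ] H) {C : Set H}
    (hne : C.Nonempty) (hcl : IsClosed C) (hconv : Convex ℝ C)
    (hU : ∀ i, Set.MapsTo (U i) C C) : ∃ p ∈ C, ∀ i, U i p = p := by
  obtain ⟨p, hp, hmin⟩ := exists_norm_eq_iInf_of_complete_convex hne hcl.isComplete hconv 0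
  refine ⟨p, hp, fun i => ?_⟩
  have h := (norm_eq_iInf_iff_real_inner_le_zero hconv hp).1 hmin _ (hU i hp)
  have h1 : ‖U i p - p‖ ^ 2 ≤ 0 := by
    rw [norm_sub_sq_real, (U i).norm_map]
    rw [zero_sub, inner_neg_left, inner_sub_right, real_inner_self_eq_norm_sq,
      real_inner_comm] at h
    linarith
  exact sub_eq_zero.1 (norm_eq_zero.1 (pow_eq_zero_iff two_ne_zero |>.1
    (le_antisymm h1 (sq_nonneg _))))

theorem setIntegral_indicator_eq_setIntegral_condExp {Ω : Type*} {m₀ m₁ mΩ : MeasurableSpace Ω}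
    {μ : Measure Ω} [IsProbabilityMeasure μ] (h01 : m₀ ≤ m₁) (h1 : m₁ ≤ mΩ) {B E : Set Ω}
    (hB : MeasurableSet B) (hE : MeasurableSet[m₁] E)
    (hBm : AEStronglyMeasurable[m₀] (μ[B.indicator (fun _ => (1 : ℝ)) | m₁]) μ) :
    ∫ x in B, E.indicator (fun _ => (1 : ℝ)) x ∂μ
      = ∫ x in B, (μ[E.indicator (fun _ => (1 : ℝ)) | m₀]) x ∂μ := by
  have h0 := h01.trans h1
  set b : Ω → ℝ := B.indicator (fun _ => (1 : ℝ)) with hb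
  set e : Ω → ℝ := E.indicator (fun _ => (1 : ℝ)) with he
  have hbi : Integrable b μ := (integrable_const (1 : ℝ)).indicator hB
  have hei : Integrable e μ := (integrable_const (1 : ℝ)).indicator (h1 _ hE)
  have hmul : ∀ v : Ω → ℝ, ∫ x in B, v x ∂μ = ∫ x, (b * v) x ∂μ := fun v => by
    rw [← integral_indicator hB]
    congr 1; ext x
    by_cases hx : x ∈ B <;> simp [hb, hx]
  have hbb : ∀ᵐ x ∂μ, ‖b x‖ ≤ 1 := .of_forall fun x => by
    by_cases hx : x ∈ B <;> simp [hb, hx]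
  have hqb : ∀ᵐ x ∂μ, |(μ[b | m₁]) x| ≤ (1 : NNReal) :=
    ae_bdd_abs_condExp_of_ae_bdd_abs (by simpa using hbb)
  have key : ∀ v : Ω → ℝ, StronglyMeasurable[m₁] v → Integrable v μ →
      ∫ x in B, v x ∂μ = ∫ x, (μ[b | m₁] * μ[v | m₀]) x ∂μ := fun v hv hvi => by
    have hbv : Integrable (b * v) μ := hvi.bdd_mul hbi.aestronglyMeasurable hbb
    rw [hmul, ← integral_condExp h1, integral_congr_ae
      (condExp_mul_of_stronglyMeasurable_right hv hbv hbi),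
      ← integral_condExp h0]
    exact integral_congr_ae (condExp_stronglyMeasurable_mul_of_bound₀ h0 hBm hvi 1 hqb)
  rw [key e (stronglyMeasurable_const.indicator hE) hei,
    key _ (stronglyMeasurable_condExp.mono h01) integrable_condExp]
  exact integral_congr_ae (Filter.EventuallyEq.rfl.mul (by
    rw [condExp_of_stronglyMeasurable h0 stronglyMeasurable_condExp integrable_condExp]))

theorem condExp_indicator_eq_of_isPiSystem {Ω : Type*} {m₀ m₁ m₂ mΩ : MeasurableSpace Ω}
    {μ : Measure Ω} [IsProbabilityMeasure μ] (h01 : m₀ ≤ m₁) (h02 : m₀ ≤ m₂) (h1 : m₁ ≤ mΩ)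
    (h2 : m₂ ≤ mΩ) {P : Set (Set Ω)} (hP : IsPiSystem P) (hgen : m₂ = .generateFrom P)
    (hBm : ∀ B ∈ P,
      AEStronglyMeasurable[m₀] (μ[B.indicator (fun _ => (1 : ℝ)) | m₁]) μ)
    {E : Set Ω} (hE : MeasurableSet[m₁] E) :
    μ[E.indicator (fun _ => (1 : ℝ)) | m₂] =ᵐ[μ] μ[E.indicator (fun _ => (1 : ℝ)) | m₀] := by
  have h0 := h01.trans h1
  set e : Ω → ℝ := E.indicator (fun _ => (1 : ℝ)) with he
  have hei : Integrable e μ := (integrable_const (1 : ℝ)).indicator (h1 _ hE)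
  have hci : Integrable (μ[e | m₀]) μ := integrable_condExp
  refine (ae_eq_condExp_of_forall_setIntegral_eq h2 hei (fun _ _ _ => hci.integrableOn)
    (fun B hB _ => ?_) (stronglyMeasurable_condExp.mono h02).aestronglyMeasurable).symm
  induction B, hB using MeasurableSpace.induction_on_inter hgen hP with
  | empty => simp
  | basic B hB =>
    refine (setIntegral_indicator_eq_setIntegral_condExp h01 h1 (h2 _ ?_) hE (hBm B hB)).symm
    rw [hgen]; exact .basic B hB
  | compl B hB ih =>
    have e1 := integral_add_compl (h2 _ hB) hci
    have e2 := integral_add_compl (h2 _ hB) hei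
    have e3 : ∫ x, (μ[e | m₀]) x ∂μ = ∫ x, e x ∂μ := integral_condExp h0
    have := ih (measure_lt_top _ _)
    linarith
  | iUnion f hd hf ih =>
    refine (hasSum_integral_iUnion (fun i => h2 _ (hf i)) hd hci.integrableOn).unique ?_
    simp_rw [fun i => ih i (measure_lt_top _ _)]
    exact hasSum_integral_iUnion (fun i => h2 _ (hf i)) hd hei.integrableOn

theorem exists_forall_smul_notMem {K X : Type*} [Group K] [MulAction K X] (s t : Finset X)
    (hs : ∀ x ∈ s, (MulAction.orbit K x).Infinite) : ∃ k : K, ∀ x ∈ s, k • x ∉ t := by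
  classical
  by_contra! hcon
  have hex : ∀ q : X × X, ∃ g : K, (∃ k : K, k • q.1 = q.2) → g • q.1 = q.2 := fun q => by
    by_cases h : ∃ k : K, k • q.1 = q.2
    · exact h.imp fun k hk _ => hk
    · exact ⟨1, fun h' => absurd h' h⟩
  choose g hg using hex
  obtain ⟨q, hq, hfin⟩ := Subgroup.exists_finiteIndex_of_leftCoset_cover (s := s ×ˢ t) (g := g)
    (H := fun q => MulAction.stabilizer K q.1) (Set.eq_univ_of_forall fun k => by
      obtain ⟨x, hx, hk⟩ := hcon k
      simp only [Set.mem_iUnion]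
      refine ⟨(x, k • x), Finset.mk_mem_product hx hk, ?_⟩
      rw [mem_leftCoset_iff, SetLike.mem_coe, MulAction.mem_stabilizer_iff, mul_smul,
        inv_smul_eq_iff]
      exact (hg (x, k • x) ⟨k, rfl⟩).symm)
  have h := hs q.1 (Finset.mem_product.1 hq).1
  exact hfin.index_ne_zero (by rw [MulAction.index_stabilizer, h.ncard])

theorem shiftAct_mul {M : Type*} (g h : Equiv.Perm M) (ω : M → unitInterval) :
    shiftAct (g * h) ω = shiftAct g (shiftAct h ω) := by
  ext a; simp [shiftAct]

theorem measurable_shiftAct {M : Type*} (g : Equiv.Perm M) : Measurable (shiftAct g) :=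
  measurable_pi_lambda _ fun a => measurable_pi_apply (g⁻¹ a)

theorem measurePreserving_shiftAct {M : Type*} {G : Subgroup (Equiv.Perm M)}
    {μ : Measure (M → unitInterval)} (hinv : ∀ g ∈ G, μ.map (shiftAct g) = μ)
    {g : Equiv.Perm M} (hg : g ∈ G) : MeasurePreserving (shiftAct g) μ μ :=
  ⟨measurable_shiftAct g, hinv g hg⟩

theorem measurableSet_invField_iff {M : Type*} {G : Subgroup (Equiv.Perm M)}
    {μ : Measure (M → unitInterval)} {A : Set M} {s : Set (M → unitInterval)} :
    MeasurableSet[invField G μ A] s ↔ MeasurableSet s ∧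
      ∀ g ∈ G, (∀ a ∈ A, g a = a) → shiftAct g ⁻¹' s =ᵐ[μ] s := by
  simp only [← measure_symmDiff_eq_zero_iff]
  refine ⟨fun h => ?_, fun h => .basic s h⟩
  induction s, h using MeasurableSpace.generateFrom_induction with
  | hC t ht => exact ht
  | empty => simp
  | compl t _ ih =>
    refine ⟨ih.1.compl, fun g hg hA => ?_⟩
    have := ih.2 g hg hA
    rw [measure_symmDiff_eq_zero_iff] at this ⊢
    exact this.compl
  | iUnion f _ ih =>
    refine ⟨.iUnion fun n => (ih n).1, fun g hg hA => ?_⟩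
    rw [measure_symmDiff_eq_zero_iff, Set.preimage_iUnion]
    exact Filter.EventuallyEq.countable_iUnion fun n =>
      measure_symmDiff_eq_zero_iff.1 ((ih n).2 g hg hA)

theorem invField_le {M : Type*} (G : Subgroup (Equiv.Perm M))
    (μ : Measure (M → unitInterval)) (A : Set M) : invField G μ A ≤ MeasurableSpace.pi :=
  fun _ hs => (measurableSet_invField_iff.1 hs).1

theorem invField_mono {M : Type*} (G : Subgroup (Equiv.Perm M))
    (μ : Measure (M → unitInterval)) : Monotone (invField G μ) := fun _ _ hAB _ hs =>
  have hs := measurableSet_invField_iff.1 hs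
  measurableSet_invField_iff.2 ⟨hs.1, fun g hg hB => hs.2 g hg fun a ha => hB a (hAB ha)⟩

theorem invField_le_invFieldOf {M : Type*} (G : Subgroup (Equiv.Perm M))
    (μ : Measure (M → unitInterval)) {A : Finset M} {D : Set M} (hA : (A : Set M) ⊆ D) :
    invField G μ (A : Set M) ≤ invFieldOf G μ D :=
  le_iSup₂_of_le A hA le_rfl

theorem invFieldOf_le {M : Type*} (G : Subgroup (Equiv.Perm M))
    (μ : Measure (M → unitInterval)) (D : Set M) : invFieldOf G μ D ≤ MeasurableSpace.pi :=
  iSup₂_le fun _ _ => invField_le _ _ _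

theorem dynTailField_le {M : Type*} (G : Subgroup (Equiv.Perm M))
    (μ : Measure (M → unitInterval)) : dynTailField G μ ≤ MeasurableSpace.pi :=
  (iInf_le _ ∅).trans (invFieldOf_le _ _ _)

theorem measurableSet_invField_of_measure_eq_zero {M : Type*} {G : Subgroup (Equiv.Perm M)}
    {μ : Measure (M → unitInterval)} (hinv : ∀ g ∈ G, μ.map (shiftAct g) = μ) (A : Set M)
    {s : Set (M → unitInterval)} (hs : MeasurableSet s) (h0 : μ s = 0) :
    MeasurableSet[invField G μ A] s :=
  measurableSet_invField_iff.2 ⟨hs, fun g hg _ => by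
    have h1 : μ (shiftAct g ⁻¹' s) = 0 := by
      rw [(measurePreserving_shiftAct hinv hg).measure_preimage hs.nullMeasurableSet, h0]
    exact (ae_eq_empty.2 h1).trans (ae_eq_empty.2 h0).symm⟩

theorem measurable_of_aestronglyMeasurable_of_null {Ω : Type*} {m mΩ : MeasurableSpace Ω}
    {μ : Measure Ω} (hm : m ≤ mΩ)
    (hnull : ∀ s, MeasurableSet[mΩ] s → μ s = 0 → MeasurableSet[m] s) {f : Ω → ℝ}
    (hf : Measurable f) (hfm : AEStronglyMeasurable[m] f μ) : Measurable[m] f := by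
  intro t ht
  have h1 : MeasurableSet[m] (hfm.mk f ⁻¹' t) := hfm.stronglyMeasurable_mk.measurable ht
  have h2 : f ⁻¹' t =ᵐ[μ] hfm.mk f ⁻¹' t := by
    filter_upwards [hfm.ae_eq_mk] with x hx
    exact congrArg (fun y => t y) hx
  have h3 := ae_eq_set.1 h2
  have h4 : f ⁻¹' t = (hfm.mk f ⁻¹' t \ (hfm.mk f ⁻¹' t \ f ⁻¹' t))
      ∪ (f ⁻¹' t \ hfm.mk f ⁻¹' t) := by
    ext x; simp only [Set.mem_union, Set.mem_sdiff]; tauto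
  rw [h4]
  exact (h1.diff (hnull _ ((hm _ h1).diff (hf ht)) h3.2)).union
    (hnull _ ((hf ht).diff (hm _ h1)) h3.1)

/-- Translating by `h` carries the σ-field of `X` to that of `h⁻¹ X`. -/
theorem MeasurableSet.preimage_shiftAct_invField {M : Type*} {G : Subgroup (Equiv.Perm M)}
    {μ : Measure (M → unitInterval)} (hinv : ∀ g ∈ G, μ.map (shiftAct g) = μ) {X Y : Set M}
    {h : Equiv.Perm M} (hh : h ∈ G) (hXY : ∀ x ∈ X, h⁻¹ x ∈ Y) {s : Set (M → unitInterval)}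
    (hs : MeasurableSet[invField G μ X] s) :
    MeasurableSet[invField G μ Y] (shiftAct h ⁻¹' s) := by
  obtain ⟨hsm, hs⟩ := measurableSet_invField_iff.1 hs
  refine measurableSet_invField_iff.2 ⟨measurable_shiftAct h hsm, fun g hg hY => ?_⟩
  have h1 := hs (h * g * h⁻¹) (G.mul_mem (G.mul_mem hh hg) (G.inv_mem hh)) fun x hx => by
    rw [Equiv.Perm.mul_apply, Equiv.Perm.mul_apply, hY _ (hXY x hx)]
    exact h.apply_symm_apply x
  have h2 : shiftAct g ⁻¹' (shiftAct h ⁻¹' s) =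
      shiftAct h ⁻¹' (shiftAct (h * g * h⁻¹) ⁻¹' s) := by
    ext ω
    simp only [Set.mem_preimage, ← shiftAct_mul, inv_mul_cancel_right]
  rw [h2]
  exact (measurePreserving_shiftAct hinv hh).quasiMeasurePreserving.preimage_ae_eq h1

theorem AEStronglyMeasurable.comp_shiftAct_invField {M : Type*} {G : Subgroup (Equiv.Perm M)}
    {μ : Measure (M → unitInterval)} (hinv : ∀ g ∈ G, μ.map (shiftAct g) = μ) {X Y : Set M}
    {h : Equiv.Perm M} (hh : h ∈ G) (hXY : ∀ x ∈ X, h⁻¹ x ∈ Y) {f : (M → unitInterval) → ℝ}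
    (hf : AEStronglyMeasurable[invField G μ X] f μ) :
    AEStronglyMeasurable[invField G μ Y] (f ∘ shiftAct h) μ :=
  ⟨hf.mk f ∘ shiftAct h,
    Measurable.stronglyMeasurable fun _ ht =>
      (hf.stronglyMeasurable_mk.measurable ht).preimage_shiftAct_invField hinv hh hXY,
    (measurePreserving_shiftAct hinv hh).quasiMeasurePreserving.ae_eq_comp hf.ae_eq_mk⟩

theorem aestronglyMeasurable_invField_of_comp_ae_eq {M : Type*} {G : Subgroup (Equiv.Perm M)}
    {μ : Measure (M → unitInterval)} (hinv : ∀ g ∈ G, μ.map (shiftAct g) = μ) {A : Set M}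
    {f : (M → unitInterval) → ℝ} (hf : AEStronglyMeasurable f μ)
    (h : ∀ g ∈ G, (∀ a ∈ A, g a = a) → f ∘ shiftAct g =ᵐ[μ] f) :
    AEStronglyMeasurable[invField G μ A] f μ := by
  refine ⟨hf.mk f, Measurable.stronglyMeasurable fun t ht =>
    measurableSet_invField_iff.2 ⟨hf.stronglyMeasurable_mk.measurable ht, fun g hg hA => ?_⟩,
    hf.ae_eq_mk⟩
  have h1 : hf.mk f ∘ shiftAct g =ᵐ[μ] hf.mk f :=
    ((measurePreserving_shiftAct hinv hg).quasiMeasurePreserving.ae_eq_comp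
      hf.ae_eq_mk.symm).trans ((h g hg hA).trans hf.ae_eq_mk)
  filter_upwards [h1] with x hx
  exact congrArg (fun y => t y) hx

theorem exists_forall_inv_apply_notMem {M : Type*} {G : Subgroup (Equiv.Perm M)}
    (horb : ∀ a b : M, b ≠ a → {c : M | ∃ g ∈ G, g a = a ∧ g b = c}.Infinite)
    {a : M} {X : Finset M} (ha : a ∉ X) (A : Finset M) :
    ∃ h ∈ G, h a = a ∧ ∀ x ∈ X, h⁻¹ x ∉ A := by
  obtain ⟨⟨k, hk⟩, hkA⟩ := exists_forall_smul_notMem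
    (K := (G ⊓ MulAction.stabilizer (Equiv.Perm M) a : Subgroup (Equiv.Perm M))) X A
    fun x hx => (horb a x (ne_of_mem_of_not_mem hx ha)).mono (by
      rintro c ⟨g, hg, hga, rfl⟩
      exact ⟨⟨g, hg, hga⟩, rfl⟩)
  refine ⟨k⁻¹, G.inv_mem hk.1, ?_, fun x hx => ?_⟩
  · rw [Equiv.Perm.inv_eq_iff_eq]; exact hk.2.symm
  · rw [inv_inv]; exact hkA x hx

/-- Since `E[1_B | F_a]` is a limit of convex combinations of translates of `1_B` by `G_a`, and
these can be pushed off any finite set `A`, it is measurable away from `A`. -/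
theorem aestronglyMeasurable_condExp_invField_singleton {M : Type*}
    {G : Subgroup (Equiv.Perm M)}
    (horb : ∀ a b : M, b ≠ a → {c : M | ∃ g ∈ G, g a = a ∧ g b = c}.Infinite)
    {μ : Measure (M → unitInterval)} [IsProbabilityMeasure μ]
    (hinv : ∀ g ∈ G, μ.map (shiftAct g) = μ) {a : M} {X : Finset M} (ha : a ∉ X)
    {B : Set (M → unitInterval)} (hB : MeasurableSet[invField G μ (X : Set M)] B)
    (A : Finset M) :
    AEStronglyMeasurable[invFieldOf G μ ((A : Set M)ᶜ)]
      (μ[B.indicator (fun _ => (1 : ℝ)) | invField G μ {a}]) μ := by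
  classical
  have hBm : MeasurableSet B := invField_le _ _ _ _ hB
  let f : Lp ℝ 2 μ := indicatorConstLp 2 hBm (measure_ne_top μ B) (1 : ℝ)
  let U : {g // g ∈ G ∧ g a = a} → (Lp ℝ 2 μ →ₗᵢ[ℝ] Lp ℝ 2 μ) := fun g =>
    Lp.compMeasurePreservingₗᵢ ℝ (shiftAct g.1) (measurePreserving_shiftAct hinv g.2.1)
  have hUcoe : ∀ g q, U g q =ᵐ[μ] q ∘ shiftAct g.1 := fun g q =>
    Lp.coeFn_compMeasurePreserving q (measurePreserving_shiftAct hinv g.2.1)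
  let S : Set (Lp ℝ 2 μ) := Set.range fun g => U g f
  have hSU : ∀ g, Set.MapsTo (U g) S S := by
    rintro g _ ⟨k, rfl⟩
    refine ⟨⟨k.1 * g.1, G.mul_mem k.2.1 g.2.1, by
      rw [Equiv.Perm.mul_apply, g.2.2, k.2.2]⟩, Lp.ext ?_⟩
    refine (hUcoe _ _).trans (((hUcoe g _).trans ?_).symm)
    refine ((measurePreserving_shiftAct hinv g.2.1).quasiMeasurePreserving.ae_eq_comp
      (hUcoe k f)).trans (.of_forall fun ω => ?_)
    simp only [Function.comp_apply, shiftAct_mul]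
  obtain ⟨p, hp, hpU⟩ := exists_forall_isometry_eq_of_isClosed_convex U
    (C := closure (convexHull ℝ S))
    (⟨f, subset_closure (subset_convexHull ℝ S ⟨⟨1, G.one_mem, rfl⟩, Lp.ext
      ((hUcoe _ _).trans (.of_forall fun ω => rfl))⟩)⟩)
    isClosed_closure (convex_convexHull ℝ S).closure (fun g q hq => by
      refine map_mem_closure (U g).continuous hq fun r hr => ?_
      have h1 := Set.mem_image_of_mem (U g).toLinearMap hr
      rw [LinearMap.image_convexHull] at h1
      exact convexHull_mono (hSU g).image_subset h1)
  have hpa : AEStronglyMeasurable[invField G μ {a}] p μ :=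
    aestronglyMeasurable_invField_of_comp_ae_eq hinv (Lp.aestronglyMeasurable p)
      fun g hg hga => by
        have h1 := hUcoe ⟨g, hg, hga a rfl⟩ p
        rw [hpU] at h1
        exact h1.symm
  have hfB : f =ᵐ[μ] B.indicator (fun _ => (1 : ℝ)) := indicatorConstLp_coeFn
  have hpB : p =ᵐ[μ] μ[B.indicator (fun _ => (1 : ℝ)) | invField G μ {a}] := by
    refine ae_eq_condExp_of_forall_setIntegral_eq (invField_le _ _ _)
      ((integrable_const (1 : ℝ)).indicator hBm)
      (fun _ _ _ => ((Lp.memLp p).integrable one_le_two).integrableOn) (fun s hs _ => ?_) hpa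
    obtain ⟨hsm, hsi⟩ := measurableSet_invField_iff.1 hs
    let v : Lp ℝ 2 μ := indicatorConstLp 2 hsm (measure_ne_top μ s) (1 : ℝ)
    have hUv : ∀ g, U g v = v := fun g => by
      refine (Lp.indicatorConstLp_compMeasurePreserving hsm (measure_ne_top μ s) (1 : ℝ)
        (measurePreserving_shiftAct hinv g.2.1)).trans (Lp.ext ?_)
      refine indicatorConstLp_coeFn.trans (.trans ?_ indicatorConstLp_coeFn.symm)
      exact indicator_ae_eq_of_ae_eq_set (hsi g.1 g.2.1 (by rintro _ rfl; exact g.2.2))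
    have hsub : closure (convexHull ℝ S) ⊆ {q | inner ℝ v q = inner ℝ v f} := by
      refine closure_minimal (convexHull_min ?_ ?_)
        (isClosed_eq (continuous_const.inner continuous_id) continuous_const)
      · rintro _ ⟨g, rfl⟩
        change inner ℝ v (U g f) = _
        conv_lhs => rw [← hUv g]
        exact (U g).inner_map_map v f
      · exact convex_hyperplane (f := fun q => inner ℝ v q)
          ⟨fun x y => inner_add_right _ _ _, fun c x => inner_smul_right _ _ _⟩ _
    have h1 : inner ℝ v p = inner ℝ v f := hsub hp
    rw [L2.inner_indicatorConstLp_one, L2.inner_indicatorConstLp_one] at h1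
    rw [h1]
    exact integral_congr_ae (ae_restrict_of_ae hfB)
  refine AEStronglyMeasurable.congr ?_ hpB
  have hcl : IsClosed {q : Lp ℝ 2 μ | AEStronglyMeasurable[invFieldOf G μ ((A : Set M)ᶜ)] q μ} :=
    isClosed_aestronglyMeasurable (invFieldOf_le _ _ _)
  have hfin : convexHull ℝ S ⊆ {q | ∃ Y : Finset M, a ∉ Y ∧
      AEStronglyMeasurable[invField G μ (Y : Set M)] q μ} := by
    refine convexHull_min ?_ ?_
    · rintro _ ⟨g, rfl⟩
      refine ⟨X.image (g.1⁻¹ : Equiv.Perm M), fun h => ?_, ?_⟩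
      · obtain ⟨x, hx, hxa⟩ := Finset.mem_image.1 h
        rw [Equiv.Perm.inv_eq_iff_eq, g.2.2] at hxa
        exact ha (hxa ▸ hx)
      · refine AEStronglyMeasurable.congr ?_ (hUcoe g f).symm
        refine AEStronglyMeasurable.comp_shiftAct_invField hinv g.2.1 (X := X)
          (fun x hx => Finset.mem_image_of_mem _ hx) ?_
        exact ⟨_, stronglyMeasurable_const.indicator hB, hfB⟩
    · rintro q ⟨Y, hY, hq⟩ r ⟨Z, hZ, hr⟩ s t - - -
      refine ⟨Y ∪ Z, by simp [hY, hZ], ?_⟩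
      have hq' := hq.mono (invField_mono G μ
        (Finset.coe_subset.2 (Finset.subset_union_left (s₂ := Z))))
      have hr' := hr.mono (invField_mono G μ
        (Finset.coe_subset.2 (Finset.subset_union_right (s₁ := Y))))
      refine ((hq'.const_smul s).add (hr'.const_smul t)).congr ?_
      exact ((Lp.coeFn_add _ _).trans
        ((Lp.coeFn_smul s q).add (Lp.coeFn_smul t r))).symm
  refine hcl.closure_subset (Metric.mem_closure_iff.2 fun ε hε => ?_)
  obtain ⟨q, hq, hpq⟩ := Metric.mem_closure_iff.1 hp ε hε
  obtain ⟨Y, hY, hqY⟩ := hfin hq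
  obtain ⟨h, hh, hha, hhA⟩ := exists_forall_inv_apply_notMem horb hY A
  refine ⟨U ⟨h, hh, hha⟩ q, ?_, ?_⟩
  · refine AEStronglyMeasurable.congr ?_ (hUcoe _ q).symm
    refine AEStronglyMeasurable.mono (invField_le_invFieldOf G μ
      (A := Y.image (h⁻¹ : Equiv.Perm M)) ?_)
      (AEStronglyMeasurable.comp_shiftAct_invField hinv hh
        (fun x hx => Finset.mem_image_of_mem _ hx) hqY)
    intro y hy
    obtain ⟨x, hx, rfl⟩ := Finset.mem_image.1 hy
    exact hhA x hx
  · rw [← hpU ⟨h, hh, hha⟩, (U _).isometry.dist_eq]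
    exact hpq

theorem aestronglyMeasurable_condExp_dynTailField_inf {M : Type*}
    {G : Subgroup (Equiv.Perm M)}
    (horb : ∀ a b : M, b ≠ a → {c : M | ∃ g ∈ G, g a = a ∧ g b = c}.Infinite)
    {μ : Measure (M → unitInterval)} [IsProbabilityMeasure μ]
    (hinv : ∀ g ∈ G, μ.map (shiftAct g) = μ) {a : M} {X : Finset M} (ha : a ∉ X)
    {B : Set (M → unitInterval)} (hB : MeasurableSet[invField G μ (X : Set M)] B) :
    AEStronglyMeasurable[dynTailField G μ ⊓ invField G μ {a}]
      (μ[B.indicator (fun _ => (1 : ℝ)) | invField G μ {a}]) μ := by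
  have hm : StronglyMeasurable[invField G μ {a}]
      (μ[B.indicator (fun _ => (1 : ℝ)) | invField G μ {a}]) := stronglyMeasurable_condExp
  suffices hM : Measurable[dynTailField G μ ⊓ invField G μ {a}]
      (μ[B.indicator (fun _ => (1 : ℝ)) | invField G μ {a}]) from
    hM.stronglyMeasurable.aestronglyMeasurable
  refine fun t ht => MeasurableSpace.measurableSet_inf.2 ⟨?_, hm.measurable ht⟩
  refine MeasurableSpace.measurableSet_iInf.2 fun A => ?_
  refine measurable_of_aestronglyMeasurable_of_null (invFieldOf_le _ _ _)
    (fun s hs h0 => invField_le_invFieldOf G μ (A := ∅) (by simp) _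
      (measurableSet_invField_of_measure_eq_zero hinv _ hs h0))
    (hm.mono (invField_le _ _ _)).measurable
    (aestronglyMeasurable_condExp_invField_singleton horb hinv ha hB A) ht

theorem isPiSystem_measurableSet_invField_finset {M : Type*} (G : Subgroup (Equiv.Perm M))
    (μ : Measure (M → unitInterval)) (D : Set M) :
    IsPiSystem {s | ∃ A : Finset M, (A : Set M) ⊆ D ∧
      MeasurableSet[invField G μ (A : Set M)] s} := by
  classical
  rintro s ⟨A, hA, hs⟩ t ⟨B, hB, ht⟩ -
  refine ⟨A ∪ B, by simp [hA, hB], ?_⟩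
  exact (invField_mono G μ (Finset.coe_subset.2 Finset.subset_union_left) _ hs).inter
    (invField_mono G μ (Finset.coe_subset.2 Finset.subset_union_right) _ ht)

theorem invFieldOf_eq_generateFrom {M : Type*} (G : Subgroup (Equiv.Perm M))
    (μ : Measure (M → unitInterval)) (D : Set M) :
    invFieldOf G μ D = .generateFrom {s | ∃ A : Finset M, (A : Set M) ⊆ D ∧
      MeasurableSet[invField G μ (A : Set M)] s} := by
  refine le_antisymm (iSup₂_le fun A hA s hs => .basic s ⟨A, hA, hs⟩)
    (MeasurableSpace.generateFrom_le ?_)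
  rintro s ⟨A, hA, hs⟩
  exact invField_le_invFieldOf G μ hA _ hs

theorem dynTailField_le_invFieldOf_compl_singleton {M : Type*} (G : Subgroup (Equiv.Perm M))
    (μ : Measure (M → unitInterval)) (a : M) :
    dynTailField G μ ≤ invFieldOf G μ {a}ᶜ :=
  (iInf_le _ {a}).trans (by rw [Finset.coe_singleton])

theorem condExp_indicator_invFieldOf_compl_singleton {M : Type*}
    {G : Subgroup (Equiv.Perm M)}
    (horb : ∀ a b : M, b ≠ a → {c : M | ∃ g ∈ G, g a = a ∧ g b = c}.Infinite)
    {μ : Measure (M → unitInterval)} [IsProbabilityMeasure μ]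
    (hinv : ∀ g ∈ G, μ.map (shiftAct g) = μ) {a : M} {E : Set (M → unitInterval)}
    (hE : MeasurableSet[invField G μ {a}] E) :
    μ[E.indicator (fun _ => (1 : ℝ)) | invFieldOf G μ {a}ᶜ] =ᵐ[μ]
      μ[E.indicator (fun _ => (1 : ℝ)) | dynTailField G μ ⊓ invField G μ {a}] := by
  refine condExp_indicator_eq_of_isPiSystem inf_le_right
    (inf_le_left.trans (dynTailField_le_invFieldOf_compl_singleton G μ a)) (invField_le _ _ _)
    (invFieldOf_le _ _ _) (isPiSystem_measurableSet_invField_finset G μ _)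
    (invFieldOf_eq_generateFrom G μ _) ?_ hE
  rintro B ⟨X, hX, hB⟩
  exact aestronglyMeasurable_condExp_dynTailField_inf horb hinv
    (fun h => hX (Finset.mem_coe.2 h) rfl) hB

theorem aestronglyMeasurable_condExp_dynTailField_biInter {M : Type*}
    {G : Subgroup (Equiv.Perm M)}
    (horb : ∀ a b : M, b ≠ a → {c : M | ∃ g ∈ G, g a = a ∧ g b = c}.Infinite)
    {μ : Measure (M → unitInterval)} [IsProbabilityMeasure μ]
    (hinv : ∀ g ∈ G, μ.map (shiftAct g) = μ) (t : Finset M)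
    {f : M → Set (M → unitInterval)} (hf : ∀ a ∈ t, MeasurableSet[invField G μ {a}] (f a)) :
    AEStronglyMeasurable[⨆ a : M, dynTailField G μ ⊓ invField G μ {a}]
      (μ[(⋂ a ∈ t, f a).indicator (fun _ => (1 : ℝ)) | dynTailField G μ]) μ := by
  classical
  induction t using Finset.induction_on with
  | empty =>
    simp only [Finset.notMem_empty, Set.iInter_of_empty, Set.iInter_univ, Set.indicator_univ]
    rw [condExp_const (dynTailField_le G μ)]
    exact aestronglyMeasurable_const
  | insert a t ha ih =>
    have hT := dynTailField_le G μ
    have hft : ∀ b ∈ t, MeasurableSet[invField G μ {b}] (f b) := fun b hb =>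
      hf b (Finset.mem_insert_of_mem hb)
    have hfa := hf a (Finset.mem_insert_self a t)
    have hm : MeasurableSet[invFieldOf G μ {a}ᶜ] (⋂ b ∈ t, f b) :=
      Finset.measurableSet_biInter _ fun b hb => by
        refine invField_le_invFieldOf G μ (A := {b}) ?_ _
          (by rw [Finset.coe_singleton]; exact hft b hb)
        rw [Finset.coe_singleton, Set.singleton_subset_iff]
        exact ne_of_mem_of_not_mem hb ha
    set e : (M → unitInterval) → ℝ := (f a).indicator (fun _ => (1 : ℝ)) with he
    set r : (M → unitInterval) → ℝ := (⋂ b ∈ t, f b).indicator (fun _ => (1 : ℝ)) with hr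
    have hei : Integrable e μ :=
      (integrable_const (1 : ℝ)).indicator (invField_le _ _ _ _ hfa)
    have hri : Integrable r μ :=
      (integrable_const (1 : ℝ)).indicator (invFieldOf_le _ _ _ _ hm)
    have hrb : ∀ᵐ x ∂μ, ‖r x‖ ≤ 1 := .of_forall fun x => by
      by_cases hx : x ∈ ⋂ b ∈ t, f b <;> simp [hr, hx]
    have hprod : (⋂ b ∈ insert a t, f b).indicator (fun _ => (1 : ℝ)) = r * e := by
      rw [Finset.set_biInter_insert, Set.inter_comm]
      ext x
      simpa using Set.inter_indicator_mul (fun _ => (1 : ℝ)) (fun _ => (1 : ℝ)) x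
    rw [hprod]
    set c := μ[e | dynTailField G μ ⊓ invField G μ {a}] with hc
    have h1 : μ[r * e | invFieldOf G μ {a}ᶜ] =ᵐ[μ] r * c :=
      (condExp_stronglyMeasurable_mul_of_bound (invFieldOf_le _ _ _)
        (stronglyMeasurable_const.indicator hm) hei 1 hrb).trans
        (Filter.EventuallyEq.rfl.mul
          (condExp_indicator_invFieldOf_compl_singleton horb hinv hfa))
    have hci : Integrable c μ := integrable_condExp
    have hcm : StronglyMeasurable[dynTailField G μ ⊓ invField G μ {a}] c :=
      stronglyMeasurable_condExp
    have h2 : μ[r * e | dynTailField G μ] =ᵐ[μ] μ[r | dynTailField G μ] * c :=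
      (condExp_condExp_of_le (dynTailField_le_invFieldOf_compl_singleton G μ a)
        (invFieldOf_le _ _ _)).symm.trans ((condExp_congr_ae h1).trans
        (condExp_mul_of_stronglyMeasurable_right (hcm.mono inf_le_left)
          (hci.bdd_mul hri.aestronglyMeasurable hrb) hri))
    exact ((ih hft).mul (hcm.mono (le_iSup (fun a : M =>
      dynTailField G μ ⊓ invField G μ {a}) a)).aestronglyMeasurable).congr h2.symm

/-- if for every `a ∈ M` all orbits of `G_a` on `M ∖ {a}` are infinite, then
for any `G`-invariant probability measure on `[0,1]^M`, up to null sets,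
`T ∩ (⋁_a F_a) = ⋁_a (T ∩ F_a)`. -/
theorem dynTail_inf_sup_coordInvFields_eq_sup_inf
    {M : Type*} [Countable M] (G : Subgroup (Equiv.Perm M))
    (horb : ∀ a b : M, b ≠ a → {c : M | ∃ g ∈ G, g a = a ∧ g b = c}.Infinite)
    (μ : Measure (M → unitInterval)) [IsProbabilityMeasure μ]
    (hinv : ∀ g ∈ G, μ.map (shiftAct g) = μ) :
    (∀ E : Set (M → unitInterval),
        MeasurableSet[dynTailField G μ ⊓ ⨆ a : M, invField G μ {a}] E →
        ∃ E' : Set (M → unitInterval),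
          MeasurableSet[⨆ a : M, dynTailField G μ ⊓ invField G μ {a}] E' ∧
          μ (symmDiff E E') = 0) ∧
    (∀ E : Set (M → unitInterval),
        MeasurableSet[⨆ a : M, dynTailField G μ ⊓ invField G μ {a}] E →
        ∃ E' : Set (M → unitInterval),
          MeasurableSet[dynTailField G μ ⊓ ⨆ a : M, invField G μ {a}] E' ∧
          μ (symmDiff E E') = 0) := by
  refine ⟨fun E hE => ?_, fun E hE => ⟨E, ?_, by simp⟩⟩
  · obtain ⟨hET, hEF⟩ := MeasurableSpace.measurableSet_inf.1 hE
    have hF : (⨆ a : M, invField G μ {a}) ≤ MeasurableSpace.pi :=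
      iSup_le fun a => invField_le _ _ _
    have hST : (⨆ a : M, dynTailField G μ ⊓ invField G μ {a}) ≤ dynTailField G μ :=
      iSup_le fun a => inf_le_left
    have h1 := condExp_indicator_eq_of_isPiSystem (μ := μ) hST
      (iSup_mono fun a => inf_le_right) (dynTailField_le G μ) hF
      (isPiSystem_piiUnionInter (fun a => {s | MeasurableSet[invField G μ {a}] s})
        (fun a => @MeasurableSpace.isPiSystem_measurableSet _ (invField G μ {a})) Set.univ)
      (by simpa using (generateFrom_piiUnionInter_measurableSet
        (fun a : M => invField G μ {a}) Set.univ).symm)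
      (by
        rintro _ ⟨t, -, f, hf, rfl⟩
        exact aestronglyMeasurable_condExp_dynTailField_biInter horb hinv t hf) hET
    rw [condExp_of_stronglyMeasurable hF (stronglyMeasurable_const.indicator hEF)
      ((integrable_const (1 : ℝ)).indicator (hF _ hEF))] at h1
    refine ⟨(μ[E.indicator (fun _ => (1 : ℝ)) |
      ⨆ a : M, dynTailField G μ ⊓ invField G μ {a}]) ⁻¹' {1},
      stronglyMeasurable_condExp.measurable (measurableSet_singleton 1),
      measure_symmDiff_eq_zero_iff.2 ?_⟩
    filter_upwards [h1] with x hx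
    refine propext ?_
    change x ∈ E ↔ _ = (1 : ℝ)
    rw [← hx]
    by_cases hxE : x ∈ E <;> simp [hxE]
  · exact (iSup_le fun a => inf_le_inf_left _ (le_iSup (fun a : M => invField G μ {a}) a) :
      (⨆ a : M, dynTailField G μ ⊓ invField G μ {a}) ≤ _) _ hE
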